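/- For any hypergraph communication situation (N,v,H), any player i∈N, any hyperlink e∈H with i∈e, and any l'∈U(H)(e): π_i(N,v,H\{e}) = Σ_{l∈U(H)(i)\{l'}} Sh_l(U(H)\{l'}, w_{U(H)\{l'}}), where w_{U(H)\{l'}} denotes the subgame of the uniform hyperlink game w restricted to the player set U(H)\{l'} (i.e., w_{U(H)\{l'}}(K)=w(K) for K⊆U(H)\{l'}), and π(N,v,H\{e}) is the position value of the hypergraph game with hyperlink set H\{e}. -/

import Mathlib

open scoped Classical
open Finset

noncomputable section

namespace HGGame

/-! ## Generic hypergraph notions -/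

variable {α : Type*}

/-- Two nodes are linked if they lie in a common hyperlink of `E`. -/
def Linked (E : Finset (Finset α)) (a b : α) : Prop :=
  ∃ e ∈ E, a ∈ e ∧ b ∈ e

/-- The component of `i` in the subhypergraph of `(α, E)` induced by the ground set `S`
(only hyperlinks contained in `S` count). -/
def compOf (E : Finset (Finset α)) (S : Finset α) (i : α) : Finset α :=
  S.filter (fun j => Relation.ReflTransGen (Linked (E.filter (fun e => e ⊆ S))) i j)

/-- The set `S/E` of components of the subhypergraph induced by `S`. -/
def components (E : Finset (Finset α)) (S : Finset α) : Finset (Finset α) :=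
  S.image (compOf E S)

/-- The hypergraph-restricted worth `v^E(S) = Σ_{T ∈ S/E} v(T)`. -/
def restrictedWorth (v : Finset α → ℝ) (E : Finset (Finset α)) (S : Finset α) : ℝ :=
  ∑ T ∈ components E S, v T

/-! ## Shapley value -/

/-- The set `σ^i` of players preceding `i` in the ordering `σ`. -/
def preceding {M : Type*} [Fintype M] (σ : M ≃ Fin (Fintype.card M)) (i : M) : Finset M :=
  Finset.univ.filter (fun j => σ j < σ i)

/-- The marginal contribution `m^σ_i(u) = u(σ^i ∪ {i}) - u(σ^i)`. -/
def marginal {M : Type*} [Fintype M] (u : Finset M → ℝ) (σ : M ≃ Fin (Fintype.card M))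
    (i : M) : ℝ :=
  u (insert i (preceding σ i)) - u (preceding σ i)

/-- The Shapley value of the TU-game `(M, u)`. -/
def shapley {M : Type*} [Fintype M] (u : Finset M → ℝ) (i : M) : ℝ :=
  ((Fintype.card M).factorial : ℝ)⁻¹ * ∑ σ : M ≃ Fin (Fintype.card M), marginal u σ i

/-- The Harsanyi dividend `λ_T(u) = Σ_{∅ ≠ S ⊆ T} (-1)^{|T|-|S|} u(S)`. -/
def dividend {M : Type*} (u : Finset M → ℝ) (T : Finset M) : ℝ :=
  ∑ S ∈ T.powerset.filter (fun S => S ≠ ∅), (-1 : ℝ) ^ (T.card - S.card) * u S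

/-! ## Hypergraph communication situations -/

variable {N : Type*} [Fintype N] [DecidableEq N]

/-- The conference game `(H, v^N)`, a TU-game with player set `H`:
`v^N(H') = Σ_{T ∈ N/H'} v(T)`. -/
def confGame (v : Finset N → ℝ) (H : Finset (Finset N)) (F : Finset {e // e ∈ H}) : ℝ :=
  restrictedWorth v (F.image Subtype.val) Finset.univ

/-- The position value `π_i(N,v,H) = Σ_{e ∈ H_i} (1/|e|) · Sh_e(H, v^N)`. -/
def positionValue (v : Finset N → ℝ) (H : Finset (Finset N)) (i : N) : ℝ :=
  ∑ e ∈ H.attach.filter (fun e => i ∈ e.val),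
    ((e.val.card : ℝ))⁻¹ * shapley (confGame v H) e

/-! ## The uniform hyperlink game -/

/-- The type of agents `(i, e, k)` of the uniform hyperlink game. -/
abbrev UElem (N : Type*) := N × Finset N × ℕ

/-- `η(H)`: the least common multiple of the hyperlink sizes. -/
def eta (H : Finset (Finset N)) : ℕ := H.lcm Finset.card

/-- `U(H)(i,e) = {(i,e,k) : k = 1, …, η(H)/|e|}`. -/
def UHie (H : Finset (Finset N)) (i : N) (e : Finset N) : Finset (UElem N) :=
  (Finset.Icc 1 (eta H / e.card)).image fun k => (i, e, k)

/-- `U(H)(i) = ∪_{e ∈ H_i} U(H)(i,e)`. -/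
def UHi (H : Finset (Finset N)) (i : N) : Finset (UElem N) :=
  (H.filter (fun e => i ∈ e)).biUnion fun e => UHie H i e

/-- `U(H)(e) = ∪_{i ∈ e} U(H)(i,e)`. -/
def UHe (H : Finset (Finset N)) (e : Finset N) : Finset (UElem N) :=
  e.biUnion fun i => UHie H i e

/-- `U(H) = ∪_{i ∈ N} U(H)(i)`. -/
def UH (H : Finset (Finset N)) : Finset (UElem N) :=
  Finset.univ.biUnion fun i : N => UHi H i

/-- `H[S] = {e ∈ H : U(H)(e) ⊆ S}`. -/
def Hof (H : Finset (Finset N)) (S : Finset (UElem N)) : Finset (Finset N) :=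
  H.filter fun e => UHe H e ⊆ S

/-- The characteristic function `w(S) = Σ_{R ∈ N/H[S]} v(R)` of the uniform hyperlink game. -/
def uw (v : Finset N → ℝ) (H : Finset (Finset N)) (S : Finset (UElem N)) : ℝ :=
  restrictedWorth v (Hof H S) Finset.univ

/-- The uniform hyperlink game `(U(H), w)` as a TU-game with player set `U(H)`. -/
def uGame (v : Finset N → ℝ) (H : Finset (Finset N)) (F : Finset {l // l ∈ UH H}) : ℝ :=
  uw v H (F.image Subtype.val)

/-! ## Möbius expansion of set functions -/

/-- The Möbius transform of a set function, defined recursively. -/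
def moebius {α : Type*} (f : Finset α → ℝ) (S : Finset α) : ℝ :=
  f S - ∑ A ∈ S.ssubsets.attach, moebius f A.1
termination_by S.card
decreasing_by exact Finset.card_lt_card (Finset.mem_ssubsets.1 A.2)

theorem sum_powerset_moebius {α : Type*} (f : Finset α → ℝ) (S : Finset α) :
    ∑ A ∈ S.powerset, moebius f A = f S := by
  have h : S.powerset = insert S S.ssubsets := by
    ext A
    simp only [Finset.mem_powerset, Finset.mem_insert, Finset.mem_ssubsets]
    exact le_iff_eq_or_lt
  rw [h, Finset.sum_insert (by simp [Finset.mem_ssubsets]), moebius, Finset.sum_attach _ (moebius f)]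
  ring

/-! ## The Shapley value of unanimity games -/

theorem marginal_unanimity_of_mem {M : Type*} [Fintype M] (T : Finset M)
    (σ : M ≃ Fin (Fintype.card M)) {i : M} (hi : i ∈ T) :
    marginal (fun F => if T ⊆ F then (1 : ℝ) else 0) σ i =
      if ∀ j ∈ T, σ j ≤ σ i then 1 else 0 := by
  have h₁ : ¬ T ⊆ preceding σ i := fun h => by simpa [preceding] using h hi
  have h₂ : T ⊆ insert i (preceding σ i) ↔ ∀ j ∈ T, σ j ≤ σ i := by
    refine forall₂_congr fun j _ => ?_
    simp only [Finset.mem_insert, preceding, Finset.mem_filter,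
      Finset.mem_univ, true_and, le_iff_eq_or_lt, σ.injective.eq_iff]
  simp [marginal, h₁, h₂]

theorem marginal_unanimity_of_notMem {M : Type*} [Fintype M] (T : Finset M)
    (σ : M ≃ Fin (Fintype.card M)) {i : M} (hi : i ∉ T) :
    marginal (fun F => if T ⊆ F then (1 : ℝ) else 0) σ i = 0 := by
  simp [marginal, Finset.subset_insert_iff_of_notMem hi]

/-- Every member of `T` is last among `T` in equally many orderings. -/
theorem sum_last_eq {M : Type*} [Fintype M] (T : Finset M) {i j : M} (hi : i ∈ T) (hj : j ∈ T) :
    (∑ σ : M ≃ Fin (Fintype.card M), if ∀ k ∈ T, σ k ≤ σ i then (1 : ℝ) else 0) =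
      ∑ σ : M ≃ Fin (Fintype.card M), if ∀ k ∈ T, σ k ≤ σ j then (1 : ℝ) else 0 := by
  have hT : ∀ k ∈ T, Equiv.swap i j k ∈ T := by
    intro k hk
    rw [Equiv.swap_apply_def]
    split_ifs <;> assumption
  refine Fintype.sum_equiv ((Equiv.swap i j).equivCongr (Equiv.refl _)) _ _ fun σ => ?_
  refine if_congr ⟨fun h k hk => ?_, fun h k hk => ?_⟩ rfl rfl
  · simpa [Equiv.equivCongr] using h _ (hT k hk)
  · simpa [Equiv.equivCongr] using h _ (hT k hk)

/-- Exactly one member of a nonempty `T` is last among `T`. -/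
theorem sum_last_eq_one {M : Type*} [Fintype M] {T : Finset M} (hT : T.Nonempty)
    (σ : M ≃ Fin (Fintype.card M)) :
    (∑ i ∈ T, if ∀ k ∈ T, σ k ≤ σ i then (1 : ℝ) else 0) = 1 := by
  obtain ⟨m, hm, hmax⟩ := T.exists_max_image σ hT
  rw [Finset.sum_eq_single_of_mem m hm, if_pos hmax]
  intro i hi him
  rw [if_neg]
  exact fun h => him (σ.injective (le_antisymm (hmax i hi) (h m hm)))

theorem shapley_unanimity {M : Type*} [Fintype M] (T : Finset M) (i : M) :
    shapley (fun F => if T ⊆ F then (1 : ℝ) else 0) i =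
      if i ∈ T then (T.card : ℝ)⁻¹ else 0 := by
  unfold shapley
  split_ifs with hi
  · simp_rw [marginal_unanimity_of_mem T _ hi]
    have hcard : (T.card : ℝ) ≠ 0 := by
      exact_mod_cast (Finset.card_pos.2 ⟨i, hi⟩).ne'
    have hfac : ((Fintype.card M).factorial : ℝ) ≠ 0 := by positivity
    have hsum : (T.card : ℝ) * (∑ σ : M ≃ Fin (Fintype.card M),
        if ∀ k ∈ T, σ k ≤ σ i then (1 : ℝ) else 0) = (Fintype.card M).factorial := by
      rw [← nsmul_eq_mul, ← Finset.sum_const,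
        Finset.sum_congr rfl fun j hj => sum_last_eq T hi hj, Finset.sum_comm,
        Finset.sum_congr rfl fun σ _ => sum_last_eq_one ⟨i, hi⟩ σ, Finset.sum_const,
        Finset.card_univ, Fintype.card_equiv (Fintype.equivFin M), nsmul_eq_mul, mul_one]
    field_simp
    linarith
  · simp_rw [marginal_unanimity_of_notMem T _ hi]
    simp

theorem shapley_sum_mul {M ι : Type*} [Fintype M] (P : Finset ι) (c : ι → ℝ)
    (u : ι → Finset M → ℝ) (i : M) :
    shapley (fun F => ∑ a ∈ P, c a * u a F) i = ∑ a ∈ P, c a * shapley (u a) i := by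
  simp only [shapley, marginal, ← Finset.sum_sub_distrib, ← mul_sub]
  rw [Finset.sum_comm, Finset.mul_sum]
  refine Finset.sum_congr rfl fun a _ => ?_
  rw [← Finset.mul_sum]
  ring

/-- The Shapley value of a game on a finset `M` expanded in unanimity games of subsets of `M`. -/
theorem shapley_eq_sum_of_expansion {α ι : Type*} [DecidableEq α] (M : Finset α) (P : Finset ι) (c : ι → ℝ)
    (T : ι → Finset α) (hT : ∀ a ∈ P, T a ⊆ M) (u : Finset {x // x ∈ M} → ℝ)
    (hu : ∀ F : Finset {x // x ∈ M},
      u F = ∑ a ∈ P, c a * if T a ⊆ F.map (Function.Embedding.subtype _) then 1 else 0)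
    (l : {x // x ∈ M}) :
    shapley u l = ∑ a ∈ P, c a * if l.1 ∈ T a then ((T a).card : ℝ)⁻¹ else 0 := by
  have hu' : u = fun F => ∑ a ∈ P, c a * if (T a).subtype (· ∈ M) ⊆ F then (1 : ℝ) else 0 := by
    funext F
    rw [hu]
    refine Finset.sum_congr rfl fun a ha => ?_
    congr 1
    refine if_congr ?_ rfl rfl
    rw [← Finset.map_subset_map (f := Function.Embedding.subtype (· ∈ M)),
      Finset.subtype_map_of_mem (hT a ha)]
  rw [hu', shapley_sum_mul]
  refine Finset.sum_congr rfl fun a ha => ?_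
  have hcard : ((T a).subtype (· ∈ M)).card = (T a).card := by
    rw [← Finset.card_map (Function.Embedding.subtype (· ∈ M)),
      Finset.subtype_map_of_mem (hT a ha)]
  have hsh : shapley (fun F => if (T a).subtype (· ∈ M) ⊆ F then (1 : ℝ) else 0) l =
      if l ∈ (T a).subtype (· ∈ M) then (((T a).subtype (· ∈ M)).card : ℝ)⁻¹ else 0 := by
    convert shapley_unanimity ((T a).subtype (· ∈ M)) l
  rw [hsh]
  simp [hcard]

/-! ## Counting agents of the uniform hyperlink game -/

theorem mem_UHie {N : Type*} [DecidableEq N] {H : Finset (Finset N)} {i : N} {e : Finset N} {l : UElem N} :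
    l ∈ UHie H i e ↔ l.1 = i ∧ l.2.1 = e ∧ l.2.2 ∈ Finset.Icc 1 (eta H / e.card) := by
  obtain ⟨j, f, k⟩ := l
  simp only [UHie, Finset.mem_image, Prod.mk.injEq]
  constructor
  · rintro ⟨k, hk, rfl, rfl, rfl⟩
    exact ⟨rfl, rfl, hk⟩
  · rintro ⟨rfl, rfl, hk⟩
    exact ⟨k, hk, rfl, rfl, rfl⟩

theorem card_UHie {N : Type*} [DecidableEq N] (H : Finset (Finset N)) (i : N)
    (e : Finset N) :
    (UHie H i e).card = eta H / e.card := by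
  rw [UHie, Finset.card_image_of_injective _ fun a b h => by simpa using h]
  simp

theorem mem_UHe {N : Type*} [DecidableEq N] {H : Finset (Finset N)} {e : Finset N} {l : UElem N} :
    l ∈ UHe H e ↔ l.1 ∈ e ∧ l.2.1 = e ∧ l.2.2 ∈ Finset.Icc 1 (eta H / e.card) := by
  simp only [UHe, Finset.mem_biUnion, mem_UHie]
  constructor
  · rintro ⟨i, hi, rfl, h⟩
    exact ⟨hi, h⟩
  · rintro ⟨hi, h⟩
    exact ⟨_, hi, rfl, h⟩

theorem mem_UHi {N : Type*} [DecidableEq N] {H : Finset (Finset N)} {i : N} {l : UElem N} :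
    l ∈ UHi H i ↔ ∃ e ∈ H, i ∈ e ∧ l ∈ UHie H i e := by
  simp [UHi, and_assoc]

theorem UHe_subset_UH {H : Finset (Finset N)} {e : Finset N} (he : e ∈ H) : UHe H e ⊆ UH H := by
  intro l hl
  obtain ⟨h₁, h₂, h₃⟩ := mem_UHe.1 hl
  simp only [UH, Finset.mem_biUnion, Finset.mem_univ, true_and, mem_UHi]
  exact ⟨l.1, e, he, h₁, mem_UHie.2 ⟨rfl, h₂, h₃⟩⟩

theorem card_UHe {N : Type*} [DecidableEq N] {H : Finset (Finset N)} {e : Finset N}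
    (he : e ∈ H) :
    (UHe H e).card = eta H := by
  rw [UHe, Finset.card_biUnion, Finset.sum_congr rfl fun i _ => card_UHie H i e,
    Finset.sum_const, smul_eq_mul]
  · exact Nat.mul_div_cancel' (Finset.dvd_lcm he)
  · intro i _ j _ hij
    rw [Function.onFun, Finset.disjoint_left]
    intro l hl hl'
    exact hij ((mem_UHie.1 hl).1.symm.trans (mem_UHie.1 hl').1)

theorem card_biUnion_UHe {N : Type*} [DecidableEq N] {H A : Finset (Finset N)}
    (hA : A ⊆ H) :
    (A.biUnion (UHe H)).card = A.card * eta H := by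
  rw [Finset.card_biUnion, Finset.sum_congr rfl fun e he => card_UHe (hA he),
    Finset.sum_const, smul_eq_mul]
  intro e _ f _ hef
  rw [Function.onFun, Finset.disjoint_left]
  intro l hl hl'
  exact hef ((mem_UHe.1 hl).2.1.symm.trans (mem_UHe.1 hl').2.1)

theorem card_filter_mem_UHi {N : Type*} [DecidableEq N] {H A : Finset (Finset N)}
    (hA : A ⊆ H) (i : N) :
    ((A.biUnion (UHe H)).filter (· ∈ UHi H i)).card =
      ∑ e ∈ A.filter (fun e => i ∈ e), eta H / e.card := by
  have h : (A.biUnion (UHe H)).filter (· ∈ UHi H i) =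
      (A.filter (fun e => i ∈ e)).biUnion (UHie H i) := by
    ext l
    simp only [Finset.mem_filter, Finset.mem_biUnion, mem_UHe, mem_UHi, mem_UHie]
    constructor
    · rintro ⟨⟨e, he, h₁, h₂, h₃⟩, f, -, -, h₄, -⟩
      exact ⟨e, ⟨he, h₄ ▸ h₁⟩, h₄, h₂, h₃⟩
    · rintro ⟨e, ⟨he, hi⟩, h₁, h₂, h₃⟩
      exact ⟨⟨e, he, h₁ ▸ hi, h₂, h₃⟩, e, hA he, hi, h₁, h₂, h₃⟩
  rw [h, Finset.card_biUnion, Finset.sum_congr rfl fun e _ => card_UHie H i e]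
  intro e _ f _ hef
  rw [Function.onFun, Finset.disjoint_left]
  intro l hl hl'
  exact hef ((mem_UHie.1 hl).2.1.symm.trans (mem_UHie.1 hl').2.1)

theorem subset_Hof_iff {N : Type*} [DecidableEq N] {H A : Finset (Finset N)}
    {S : Finset (UElem N)} :
    A ⊆ Hof H S ↔ A ⊆ H ∧ A.biUnion (UHe H) ⊆ S := by
  simp only [Finset.biUnion_subset, Hof, Finset.subset_iff (s₁ := A), Finset.mem_filter]
  exact ⟨fun h => ⟨fun e he => (h he).1, fun e he => (h he).2⟩,
    fun h e he => ⟨h.1 he, h.2 e he⟩⟩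

theorem sum_attach_filter_if {α : Type*} [DecidableEq α] (M T : Finset α) (hT : T ⊆ M)
    (p : α → Prop) [DecidablePred p] (f : α → ℝ) :
    (∑ l ∈ M.attach.filter (fun l => p l.1), if l.1 ∈ T then f l.1 else 0) =
      ∑ l ∈ T.filter p, f l := by
  rw [Finset.sum_filter, Finset.sum_attach M fun l => if p l then if l ∈ T then f l else 0 else 0,
    Finset.sum_filter, ← Finset.sum_subset hT]
  · exact Finset.sum_congr rfl fun l hl => by simp [hl]
  · intro l _ hl
    simp [hl]

/-- The position value in terms of the Möbius transform of the conference game. -/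
theorem positionValue_eq_sum_moebius (v : Finset N → ℝ) (H : Finset (Finset N)) (i : N) :
    positionValue v H i =
      ∑ A ∈ H.powerset, moebius (fun E => restrictedWorth v E Finset.univ) A *
        ∑ e ∈ A.filter (fun e => i ∈ e), (e.card : ℝ)⁻¹ * (A.card : ℝ)⁻¹ := by
  have hu : ∀ F : Finset {e // e ∈ H}, confGame v H F =
      ∑ A ∈ H.powerset, moebius (fun E => restrictedWorth v E Finset.univ) A *
        if A ⊆ F.map (Function.Embedding.subtype _) then 1 else 0 := by
    intro F
    have hF : F.image Subtype.val = F.map (Function.Embedding.subtype _) := by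
      ext x
      simp
    rw [confGame, hF, ← sum_powerset_moebius fun E => restrictedWorth v E Finset.univ]
    simp only [mul_ite, mul_one, mul_zero]
    rw [← Finset.sum_filter]
    refine Finset.sum_congr ?_ fun _ _ => rfl
    ext A
    simp only [Finset.mem_powerset, Finset.mem_filter]
    refine ⟨fun h => ⟨h.trans ?_, h⟩, And.right⟩
    intro x hx
    obtain ⟨y, -, rfl⟩ := Finset.mem_map.1 hx
    exact y.2
  have hsh := shapley_eq_sum_of_expansion H H.powerset _ (fun A => A)
    (fun A hA => Finset.mem_powerset.1 hA) _ hu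
  simp_rw [positionValue, hsh, Finset.mul_sum (s := H.powerset)]
  rw [Finset.sum_comm]
  refine Finset.sum_congr rfl fun A hA => ?_
  rw [← sum_attach_filter_if H A (Finset.mem_powerset.1 hA), Finset.mul_sum]
  refine Finset.sum_congr rfl fun e _ => ?_
  split_ifs <;> ring

/-- The Möbius expansion of the subgame of the uniform hyperlink game that lacks an agent of `e`. -/
theorem uw_erase_eq_sum_moebius (v : Finset N → ℝ) (H : Finset (Finset N)) (e : Finset N)
    (l' : UElem N) (hl' : l' ∈ UHe H e) (F : Finset {x // x ∈ (UH H).erase l'}) :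
    uw v H (F.image Subtype.val) =
      ∑ A ∈ (H.erase e).powerset, moebius (fun E => restrictedWorth v E Finset.univ) A *
        if A.biUnion (UHe H) ⊆ F.map (Function.Embedding.subtype _) then 1 else 0 := by
  have hF : F.image Subtype.val = F.map (Function.Embedding.subtype _) := by
    ext x
    simp
  rw [uw, hF, ← sum_powerset_moebius fun E => restrictedWorth v E Finset.univ]
  simp only [mul_ite, mul_one, mul_zero]
  rw [← Finset.sum_filter]
  refine Finset.sum_congr ?_ fun _ _ => rfl
  ext A
  simp only [Finset.mem_powerset, Finset.mem_filter, subset_Hof_iff, Finset.subset_erase]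
  refine ⟨fun h => ⟨⟨h.1, fun heA => ?_⟩, h.2⟩, fun h => ⟨h.1.1, h.2⟩⟩
  obtain ⟨y, -, hy⟩ := Finset.mem_map.1 (h.2 (Finset.mem_biUnion.2 ⟨e, heA, hl'⟩))
  exact (Finset.mem_erase.1 y.2).1 hy

theorem biUnion_UHe_subset_erase {H A : Finset (Finset N)} {e : Finset N} {l' : UElem N}
    (hl' : l' ∈ UHe H e) (hA : A ⊆ H.erase e) : A.biUnion (UHe H) ⊆ (UH H).erase l' := by
  intro l hl
  obtain ⟨f, hf, hlf⟩ := Finset.mem_biUnion.1 hl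
  have hfH := Finset.mem_erase.1 (hA hf)
  refine Finset.mem_erase.2 ⟨?_, UHe_subset_UH hfH.2 hlf⟩
  rintro rfl
  exact hfH.1 ((mem_UHe.1 hlf).2.1.symm.trans (mem_UHe.1 hl').2.1)

/-- Relative to the number of agents representing the hyperlinks of `A`, player `i` controls
`1 / |e|` of each hyperlink `e ∈ A` containing `i`. -/
theorem card_filter_mem_UHi_mul_inv {N : Type*} [DecidableEq N] {H A : Finset (Finset N)}
    (hH : ∀ e ∈ H, 1 < e.card) (hA : A ⊆ H) (i : N) :
    (((A.biUnion (UHe H)).filter (· ∈ UHi H i)).card : ℝ) * ((A.biUnion (UHe H)).card : ℝ)⁻¹ =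
      ∑ e ∈ A.filter (fun e => i ∈ e), (e.card : ℝ)⁻¹ * (A.card : ℝ)⁻¹ := by
  have hη : (eta H : ℝ) ≠ 0 := by
    rw [Nat.cast_ne_zero, eta, Ne, Finset.lcm_eq_zero_iff]
    rintro ⟨f, hf, hf0⟩
    have := hH f hf
    omega
  rw [card_filter_mem_UHi hA, card_biUnion_UHe hA, Nat.cast_sum, Finset.sum_mul]
  refine Finset.sum_congr rfl fun f hf => ?_
  have hfH := hA (Finset.mem_filter.1 hf).1
  have hf0 : (f.card : ℝ) ≠ 0 := by
    have := hH f hfH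
    exact_mod_cast (by omega : f.card ≠ 0)
  have hdvd : f.card ∣ eta H := Finset.dvd_lcm hfH
  rw [Nat.cast_div hdvd hf0]
  push_cast
  field_simp

/-- Lemma 1: the position value of `(N, v, H \ {e})` equals the aggregated Shapley
value, over `U(H)(i) \ {l'}`, of the subgame of the uniform hyperlink game on the
player set `U(H) \ {l'}`, for any `l' ∈ U(H)(e)`. -/
theorem position_value_erase_eq_subgame_shapley
    {N : Type*} [Fintype N] [DecidableEq N]
    (v : Finset N → ℝ) (H : Finset (Finset N))
    (hN : 2 ≤ Fintype.card N)
    (hv0 : v ∅ = 0) (hzn : ∀ i : N, v {i} = 0)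
    (hH : ∀ e ∈ H, 1 < e.card)
    (i : N) (e : Finset N) (he : e ∈ H) (hie : i ∈ e)
    (l' : UElem N) (hl' : l' ∈ UHe H e) :
    positionValue v (H.erase e) i =
      ∑ l ∈ ((UH H).erase l').attach.filter (fun l => l.val ∈ UHi H i),
        shapley (fun F : Finset {x // x ∈ (UH H).erase l'} =>
          uw v H (F.image Subtype.val)) l := by
  have hT : ∀ A ∈ (H.erase e).powerset, A.biUnion (UHe H) ⊆ (UH H).erase l' :=
    fun A hA => biUnion_UHe_subset_erase hl' (Finset.mem_powerset.1 hA)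
  have hsh := shapley_eq_sum_of_expansion ((UH H).erase l') (H.erase e).powerset
    (moebius fun E => restrictedWorth v E Finset.univ) (fun A => A.biUnion (UHe H)) hT
    (fun F => uw v H (F.image Subtype.val)) (uw_erase_eq_sum_moebius v H e l' hl')
  rw [positionValue_eq_sum_moebius, Finset.sum_congr rfl fun l _ => hsh l, Finset.sum_comm]
  refine Finset.sum_congr rfl fun A hA => ?_
  have hAH : A ⊆ H := (Finset.mem_powerset.1 hA).trans (Finset.erase_subset e H)
  rw [← Finset.mul_sum, sum_attach_filter_if _ _ (hT A hA) (· ∈ UHi H i)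
      fun _ => ((A.biUnion (UHe H)).card : ℝ)⁻¹,
    Finset.sum_const, nsmul_eq_mul, card_filter_mem_UHi_mul_inv hH hAH]

end HGGame
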